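/- Let (C_i)_{i∈ℤ₊} be finite-length abelian categories and F_{i-1,i}: C_i → C_{i-1} shortening functors. Let A be a finite-length category equipped with shortening functors G_i: A → C_i and natural isomorphisms η_{i-1,i}: F_{i-1,i} ∘ G_i ≅ G_{i-1} for every i ≥ 1. Then the induced functor G: A → lim C_i, A ↦ ({G_i(A)}, {η_{i-1,i}}), factors through the restricted inverse limit lim_restr C_i, is itself a shortening functor with ℓ(G(A)) = max_i ℓ_{C_i}(G_i(A)) ≤ ℓ_A(A), and satisfies Pr_i ∘ G ≅ G_i for every i ∈ ℤ₊. -/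

import Mathlib

open CategoryTheory Limits

universe v u v₁ u₁ v₂ u₂

namespace InvLim

variable {C : ℕ → Type u} [∀ i, Category.{v} (C i)]

/-- An object of the inverse limit category: a family of objects `obj i ∈ C i` together with
isomorphisms `φ_{i,i+1} : F i (obj (i+1)) ≅ obj i`. -/
structure Obj (F : ∀ i : ℕ, C (i + 1) ⥤ C i) where
  obj : ∀ i, C i
  iso : ∀ i, (F i).obj (obj (i + 1)) ≅ obj i

variable (F : ∀ i : ℕ, C (i + 1) ⥤ C i)

/-- A morphism in the inverse limit category: a family of componentwise morphisms compatible
with the structure isomorphisms. -/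
@[ext]
structure Hom (X Y : Obj F) where
  hom : ∀ i, X.obj i ⟶ Y.obj i
  comm : ∀ i, (F i).map (hom (i + 1)) ≫ (Y.iso i).hom = (X.iso i).hom ≫ hom i

/-- The inverse limit category `lim C_i`. -/
instance : Category (Obj F) where
  Hom X Y := Hom F X Y
  id X := ⟨fun _ => 𝟙 _, fun i => by simp⟩
  comp f g := ⟨fun i => f.hom i ≫ g.hom i, fun i => by
    rw [Functor.map_comp, Category.assoc, g.comm, ← Category.assoc, f.comm, Category.assoc]⟩
  id_comp f := by apply Hom.ext; funext i; exact Category.id_comp _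
  comp_id f := by apply Hom.ext; funext i; exact Category.comp_id _
  assoc f g h := by apply Hom.ext; funext i; exact Category.assoc _ _ _

/-- The componentwise morphisms of a morphism in the inverse limit category. -/
def homApp {X Y : Obj F} (f : X ⟶ Y) (i : ℕ) : X.obj i ⟶ Y.obj i :=
  Hom.hom f i

/-- The projection functor `Pr i : lim C_j ⥤ C i`. -/
def Pr (i : ℕ) : Obj F ⥤ C i where
  obj X := X.obj i
  map f := Hom.hom f i
  map_id _ := rfl
  map_comp _ _ := rfl



/-- `X` admits a Jordan–Hölder filtration with `n` simple subquotients, i.e. `ℓ(X) = n`. -/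
def HasLength {A : Type u₁} [Category.{v₁} A] [Abelian A] (X : A) (n : ℕ) : Prop :=
  ∃ s : Fin (n + 1) → Subobject X, Monotone s ∧ s 0 = ⊥ ∧ s (Fin.last n) = ⊤ ∧
    ∀ i : Fin n, ∃ h : s i.castSucc ≤ s i.succ,
      Simple (cokernel (Subobject.ofLE _ _ h))

/-- A finite-length category: every object admits a Jordan–Hölder filtration. -/
def FiniteLength (A : Type u₁) [Category.{v₁} A] [Abelian A] : Prop :=
  ∀ X : A, ∃ n, HasLength X n

/-- An object is simple or zero. -/
def SimpleOrZero (A : Type u₁) [Category.{v₁} A] [Limits.HasZeroMorphisms A] (X : A) : Prop :=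
  Simple X ∨ Limits.IsZero X

/-- An exact functor between finite-length abelian categories is shortening if it does not
increase lengths. -/
def Shortening {A : Type u₁} {B : Type u₂} [Category.{v₁} A] [Abelian A]
    [Category.{v₂} B] [Abelian B] (G : A ⥤ B) : Prop :=
  ∀ (X : A) (n m : ℕ), HasLength X n → HasLength (G.obj X) m → m ≤ n

variable {C : ℕ → Type u} [∀ i, Category.{v} (C i)] [∀ i, Abelian (C i)]

/-- The objects of the restricted inverse limit: those whose sequence of component lengths is
bounded. -/
def RestrP (F : ∀ i : ℕ, C (i + 1) ⥤ C i) (X : InvLim.Obj F) : Prop :=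
  ∃ N : ℕ, ∀ (i : ℕ) (n : ℕ), HasLength (X.obj i) n → n ≤ N



end InvLim

namespace InvLim

section Limits

universe w w'

variable {C : ℕ → Type u} [∀ i, Category.{v} (C i)] {F : ∀ i : ℕ, C (i + 1) ⥤ C i}

@[ext]
lemma hom_ext {X Y : Obj F} {f g : X ⟶ Y} (h : ∀ i, (Pr F i).map f = (Pr F i).map g) : f = g :=
  Hom.ext (funext h)

variable (F) in
/-- The structure isomorphisms of the objects of `lim C_i`, as a natural isomorphism. -/
def prCompIso (i : ℕ) : Pr F (i + 1) ⋙ F i ≅ Pr F i :=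
  NatIso.ofComponents (fun X => X.iso i) (fun f => Hom.comm f i)

/-- Constructor for morphisms in `lim C_i`. -/
def homMk {X Y : Obj F} (g : ∀ i, (Pr F i).obj X ⟶ (Pr F i).obj Y)
    (comm : ∀ i, (F i).map (g (i + 1)) ≫ (prCompIso F i).hom.app Y =
      (prCompIso F i).hom.app X ≫ g i) : X ⟶ Y :=
  Hom.mk g comm

@[simp]
lemma Pr_map_homMk {X Y : Obj F} (g : ∀ i, (Pr F i).obj X ⟶ (Pr F i).obj Y)
    (comm : ∀ i, (F i).map (g (i + 1)) ≫ (prCompIso F i).hom.app Y =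
      (prCompIso F i).hom.app X ≫ g i) (i : ℕ) : (Pr F i).map (homMk g comm) = g i :=
  rfl

lemma map_Pr_map_prCompIso_hom {X Y : Obj F} (f : X ⟶ Y) (i : ℕ) :
    (F i).map ((Pr F (i + 1)).map f) ≫ (prCompIso F i).hom.app Y =
      (prCompIso F i).hom.app X ≫ (Pr F i).map f :=
  (prCompIso F i).hom.naturality f

lemma map_Pr_map_prCompIso_hom_assoc {X Y : Obj F} (f : X ⟶ Y) (i : ℕ) {Z : C i}
    (h : (Pr F i).obj Y ⟶ Z) :
    (F i).map ((Pr F (i + 1)).map f) ≫ (prCompIso F i).hom.app Y ≫ h =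
      (prCompIso F i).hom.app X ≫ (Pr F i).map f ≫ h := by
  rw [← Category.assoc, map_Pr_map_prCompIso_hom, Category.assoc]

lemma map_comp_prCompIso_hom_of_fac {X Y Z : Obj F} (d : ∀ k, (Pr F k).obj X ⟶ (Pr F k).obj Y)
    (z : Z ⟶ X) (t : Z ⟶ Y) (fac : ∀ k, (Pr F k).map z ≫ d k = (Pr F k).map t) (i : ℕ) :
    (F i).map ((Pr F (i + 1)).map z) ≫ (F i).map (d (i + 1)) ≫ (prCompIso F i).hom.app Y =
      (F i).map ((Pr F (i + 1)).map z) ≫ (prCompIso F i).hom.app X ≫ d i := by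
  rw [map_Pr_map_prCompIso_hom_assoc, fac, ← map_Pr_map_prCompIso_hom, ← fac,
    Functor.map_comp_assoc]

lemma map_comp_map_of_fac {X Y Z : Obj F} (d : ∀ k, (Pr F k).obj X ⟶ (Pr F k).obj Y)
    (z : Y ⟶ Z) (t : X ⟶ Z) (fac : ∀ k, d k ≫ (Pr F k).map z = (Pr F k).map t) (i : ℕ) :
    (F i).map (d (i + 1)) ≫ (F i).map ((Pr F (i + 1)).map z) =
      ((prCompIso F i).hom.app X ≫ d i ≫ (prCompIso F i).inv.app Y) ≫
        (F i).map ((Pr F (i + 1)).map z) := by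
  have h := (prCompIso F i).inv.naturality z
  rw [Functor.comp_map] at h
  rw [Category.assoc, Category.assoc, ← h, reassoc_of% fac i, ← map_Pr_map_prCompIso_hom_assoc,
    ← Functor.map_comp, fac]
  simp

/-- A componentwise isomorphism is an isomorphism. -/
lemma isIso_of_isIso_Pr_map {X Y : Obj F} (f : X ⟶ Y) (h : ∀ i, IsIso ((Pr F i).map f)) :
    IsIso f := by
  refine ⟨homMk (fun i => inv ((Pr F i).map f)) (fun i => ?_), ?_, ?_⟩
  · rw [Functor.map_inv, IsIso.inv_comp_eq, ← Category.assoc, IsIso.eq_comp_inv,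
      map_Pr_map_prCompIso_hom]
  · ext i; simp
  · ext i; simp

variable {J : Type w} [Category.{w'} J]

/-- A cocone in `lim C_i` which is componentwise a colimit is a colimit. -/
def isColimitOfIsColimitPr {K : J ⥤ Obj F} [∀ i, PreservesColimitsOfShape J (F i)] (c : Cocone K)
    (h : ∀ i, IsColimit ((Pr F i).mapCocone c)) : IsColimit c where
  desc s := homMk (fun i => (h i).desc ((Pr F i).mapCocone s)) fun i =>
    (isColimitOfPreserves (F i) (h (i + 1))).hom_ext fun j =>
      map_comp_prCompIso_hom_of_fac (fun k => (h k).desc ((Pr F k).mapCocone s))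
        (c.ι.app j) (s.ι.app j) (fun k => (h k).fac _ j) i
  fac s j := by
    ext i
    exact (h i).fac ((Pr F i).mapCocone s) j
  uniq s m hm := by
    ext i
    refine (h i).uniq ((Pr F i).mapCocone s) _ fun j => ?_
    exact congrArg (Pr F i).map (hm j)

/-- A cone in `lim C_i` which is componentwise a limit is a limit. -/
def isLimitOfIsLimitPr {K : J ⥤ Obj F} [∀ i, PreservesLimitsOfShape J (F i)] (c : Cone K)
    (h : ∀ i, IsLimit ((Pr F i).mapCone c)) : IsLimit c where
  lift s := homMk (fun i => (h i).lift ((Pr F i).mapCone s)) fun i => by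
    have e : (F i).map ((h (i + 1)).lift ((Pr F (i + 1)).mapCone s)) =
        (prCompIso F i).hom.app s.pt ≫ (h i).lift ((Pr F i).mapCone s) ≫
          (prCompIso F i).inv.app c.pt :=
      (isLimitOfPreserves (F i) (h (i + 1))).hom_ext fun j =>
        map_comp_map_of_fac (fun k => (h k).lift ((Pr F k).mapCone s))
          (c.π.app j) (s.π.app j) (fun k => (h k).fac _ j) i
    rw [e, Category.assoc, Category.assoc, Iso.inv_hom_id_app]
    exact congrArg _ (Category.comp_id _)
  fac s j := by
    ext i
    exact (h i).fac ((Pr F i).mapCone s) j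
  uniq s m hm := by
    ext i
    refine (h i).uniq ((Pr F i).mapCone s) _ fun j => ?_
    exact congrArg (Pr F i).map (hm j)

/-- The componentwise colimit cocone in `lim C_i`. -/
noncomputable def colimitCocone [∀ i, HasColimitsOfShape J (C i)]
    [∀ i, PreservesColimitsOfShape J (F i)] (K : J ⥤ Obj F) : Cocone K where
  pt :=
    { obj := fun i => colimit (K ⋙ Pr F i)
      iso := fun i => IsColimit.coconePointsIsoOfNatIso
        (isColimitOfPreserves (F i) (colimit.isColimit (K ⋙ Pr F (i + 1))))
        (colimit.isColimit (K ⋙ Pr F i)) (Functor.isoWhiskerLeft K (prCompIso F i)) }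
  ι :=
    { app := fun j => ⟨fun i => colimit.ι (K ⋙ Pr F i) j, fun i =>
        IsColimit.comp_coconePointsIsoOfNatIso_hom
          (isColimitOfPreserves (F i) (colimit.isColimit (K ⋙ Pr F (i + 1))))
          (colimit.isColimit (K ⋙ Pr F i)) (Functor.isoWhiskerLeft K (prCompIso F i)) j⟩
      naturality := fun j j' f => by
        ext i
        exact (colimit.cocone (K ⋙ Pr F i)).ι.naturality f }

/-- The componentwise limit cone in `lim C_i`. -/
noncomputable def limitCone [∀ i, HasLimitsOfShape J (C i)]
    [∀ i, PreservesLimitsOfShape J (F i)] (K : J ⥤ Obj F) : Cone K where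
  pt :=
    { obj := fun i => limit (K ⋙ Pr F i)
      iso := fun i => IsLimit.conePointsIsoOfNatIso
        (isLimitOfPreserves (F i) (limit.isLimit (K ⋙ Pr F (i + 1))))
        (limit.isLimit (K ⋙ Pr F i)) (Functor.isoWhiskerLeft K (prCompIso F i)) }
  π :=
    { app := fun j => ⟨fun i => limit.π (K ⋙ Pr F i) j, fun i =>
        (IsLimit.conePointsIsoOfNatIso_hom_comp
          (isLimitOfPreserves (F i) (limit.isLimit (K ⋙ Pr F (i + 1))))
          (limit.isLimit (K ⋙ Pr F i)) (Functor.isoWhiskerLeft K (prCompIso F i)) j).symm⟩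
      naturality := fun j j' f => by
        ext i
        exact (limit.cone (K ⋙ Pr F i)).π.naturality f }

instance hasColimitsOfShape [∀ i, HasColimitsOfShape J (C i)]
    [∀ i, PreservesColimitsOfShape J (F i)] : HasColimitsOfShape J (Obj F) where
  has_colimit K := ⟨⟨⟨colimitCocone K,
    isColimitOfIsColimitPr _ fun i => colimit.isColimit (K ⋙ Pr F i)⟩⟩⟩

instance hasLimitsOfShape [∀ i, HasLimitsOfShape J (C i)]
    [∀ i, PreservesLimitsOfShape J (F i)] : HasLimitsOfShape J (Obj F) where
  has_limit K := ⟨⟨⟨limitCone K, isLimitOfIsLimitPr _ fun i => limit.isLimit (K ⋙ Pr F i)⟩⟩⟩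

instance [∀ i, HasColimitsOfShape J (C i)] [∀ i, PreservesColimitsOfShape J (F i)] (i : ℕ) :
    PreservesColimitsOfShape J (Pr F i) where
  preservesColimit {K} := preservesColimit_of_preserves_colimit_cocone
    (isColimitOfIsColimitPr (colimitCocone K) fun i => colimit.isColimit (K ⋙ Pr F i))
    (colimit.isColimit (K ⋙ Pr F i))

instance [∀ i, HasLimitsOfShape J (C i)] [∀ i, PreservesLimitsOfShape J (F i)] (i : ℕ) :
    PreservesLimitsOfShape J (Pr F i) where
  preservesLimit {K} := preservesLimit_of_preserves_limit_cone
    (isLimitOfIsLimitPr (limitCone K) fun i => limit.isLimit (K ⋙ Pr F i))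
    (limit.isLimit (K ⋙ Pr F i))

/-- A functor to `lim C_i` preserves the colimits preserved by all its components. -/
lemma preservesColimitsOfShape_of_comp_Pr {A : Type*} [Category* A] (H : A ⥤ Obj F)
    [∀ i, PreservesColimitsOfShape J (F i)] [∀ i, PreservesColimitsOfShape J (H ⋙ Pr F i)] :
    PreservesColimitsOfShape J H where
  preservesColimit := ⟨fun {c} hc => ⟨isColimitOfIsColimitPr (H.mapCocone c)
    fun i => isColimitOfPreserves (H ⋙ Pr F i) hc⟩⟩

/-- A functor to `lim C_i` preserves the limits preserved by all its components. -/
lemma preservesLimitsOfShape_of_comp_Pr {A : Type*} [Category* A] (H : A ⥤ Obj F)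
    [∀ i, PreservesLimitsOfShape J (F i)] [∀ i, PreservesLimitsOfShape J (H ⋙ Pr F i)] :
    PreservesLimitsOfShape J H where
  preservesLimit := ⟨fun {c} hc => ⟨isLimitOfIsLimitPr (H.mapCone c)
    fun i => isLimitOfPreserves (H ⋙ Pr F i) hc⟩⟩

end Limits

section Abelian

lemma additive_of_preservesFiniteLimits {A : Type u₁} {B : Type u₂} [Category.{v₁} A] [Abelian A]
    [Category.{v₂} B] [Abelian B] (G : A ⥤ B) [PreservesFiniteLimits G] : G.Additive := by
  have : G.PreservesZeroMorphisms := Functor.preservesZeroMorphisms_of_preserves_terminal_object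
  exact Functor.additive_of_preserves_binary_products G

variable {C : ℕ → Type u} [∀ i, Category.{v} (C i)] [∀ i, Abelian (C i)]
  (F : ∀ i : ℕ, C (i + 1) ⥤ C i)

/-- The componentwise addition of morphisms in `lim C_i`. -/
@[reducible]
def homAddCommGroup [∀ i, (F i).Additive] (X Y : Obj F) : AddCommGroup (X ⟶ Y) :=
  letI : Add (X ⟶ Y) := ⟨fun f g => homMk (fun i => (Pr F i).map f + (Pr F i).map g) fun i => by
    rw [Functor.map_add, Preadditive.add_comp, Preadditive.comp_add,
      map_Pr_map_prCompIso_hom, map_Pr_map_prCompIso_hom]⟩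
  letI : Zero (X ⟶ Y) := ⟨homMk (fun i => 0) fun i => by simp⟩
  letI : Neg (X ⟶ Y) := ⟨fun f => homMk (fun i => -(Pr F i).map f) fun i => by
    rw [Functor.map_neg, Preadditive.neg_comp, Preadditive.comp_neg, map_Pr_map_prCompIso_hom]⟩
  { add_assoc f g h := Hom.ext (funext fun i => add_assoc _ _ _)
    zero_add f := Hom.ext (funext fun i => zero_add _)
    add_zero f := Hom.ext (funext fun i => add_zero _)
    nsmul := nsmulRec
    zsmul := zsmulRec
    add_comm f g := Hom.ext (funext fun i => add_comm _ _)
    neg_add_cancel f := Hom.ext (funext fun i => neg_add_cancel _) }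

/-- The componentwise preadditive structure on `lim C_i`. -/
@[reducible]
def preadditive [∀ i, (F i).Additive] : Preadditive (Obj F) where
  homGroup := homAddCommGroup F
  add_comp _ _ _ _ _ _ := Hom.ext (funext fun _ => Preadditive.add_comp _ _ _ _ _ _)
  comp_add _ _ _ _ _ _ := Hom.ext (funext fun _ => Preadditive.comp_add _ _ _ _ _ _)

/-- The inverse limit of abelian categories along exact functors is abelian. -/
@[reducible]
noncomputable def abelian [∀ i, PreservesFiniteLimits (F i)]
    [∀ i, PreservesFiniteColimits (F i)] : Abelian (Obj F) :=
  have : ∀ i, (F i).Additive := fun i => additive_of_preservesFiniteLimits (F i)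
  letI := preadditive F
  have : ∀ i, (Pr F i).Additive := fun i => { map_add := rfl }
  have : HasFiniteProducts (Obj F) := ⟨fun _ => inferInstance⟩
  have : ∀ {X Y : Obj F} (f : X ⟶ Y), IsIso (Abelian.coimageImageComparison f) := fun f =>
    isIso_of_isIso_Pr_map _ fun i => by
      rw [Arrow.isIso_iff_isIso_of_isIso
        (Abelian.PreservesCoimageImageComparison.iso (Pr F i) f).hom]
      infer_instance
  Abelian.ofCoimageImageComparisonIsIso

end Abelian

section Length

variable {A : Type u₁} [Category.{v₁} A] [Abelian A]

/-- Inductive description of the length: `IsLen X n` if `X` is obtained from a zero object by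
`n` successive extensions by simple objects. -/
inductive IsLen : A → ℕ → Prop
  | zero {X : A} (hX : IsZero X) : IsLen X 0
  | succ {X Y Z : A} {n : ℕ} (f : X ⟶ Y) (g : Y ⟶ Z) (w : f ≫ g = 0)
      (h : (ShortComplex.mk f g w).ShortExact) (hZ : Simple Z) (hX : IsLen X n) : IsLen Y (n + 1)

lemma IsLen.of_iso {X Y : A} (e : X ≅ Y) {n : ℕ} (h : IsLen X n) : IsLen Y n := by
  cases h with
  | zero hX => exact .zero (hX.of_iso e.symm)
  | succ f g w h hZ hX =>
    refine .succ (f ≫ e.hom) (e.inv ≫ g) (by simp [w]) ?_ hZ hX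
    exact ShortComplex.shortExact_of_iso (S₁ := ShortComplex.mk f g w)
      (ShortComplex.isoMk (Iso.refl _) e (Iso.refl _) (by simp) (by simp)) h

lemma shortExact_cokernel {X Y : A} (f : X ⟶ Y) [Mono f] :
    (ShortComplex.mk f (cokernel.π f) (cokernel.condition f)).ShortExact :=
  { exact := ShortComplex.exact_cokernel f }

lemma shortExact_kernel {X Y : A} (f : X ⟶ Y) [Epi f] :
    (ShortComplex.mk (kernel.ι f) f (kernel.condition f)).ShortExact :=
  { exact := ShortComplex.exact_kernel f }

lemma eq_zero_of_isLen_of_isZero {X : A} {n : ℕ} (h : IsLen X n) (hX : IsZero X) : n = 0 := by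
  cases h with
  | zero _ => rfl
  | succ f g w h hZ _ =>
    have : Epi g := h.epi_g
    exact (Simple.not_isZero _ (hX.of_epi g)).elim

lemma isLen_one_of_simple {X : A} (hX : Simple X) : IsLen X 1 :=
  .succ _ (𝟙 X) (kernel.condition _) (shortExact_kernel (𝟙 X)) hX
    (.zero (isZero_kernel_of_mono _))

lemma simple_of_isLen_one {X : A} (h : IsLen X 1) : Simple X := by
  obtain _ | @⟨Y, _, Z, _, f, g, w, h, hZ, hY⟩ := h
  obtain ⟨hY⟩ := hY
  have : Mono g := h.exact.mono_g (hY.eq_of_src _ _)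
  have : Epi g := h.epi_g
  have : IsIso g := isIso_of_mono_of_epi g
  exact Simple.of_iso (asIso g)

lemma isZero_of_isLen_zero {X : A} (h : IsLen X 0) : IsZero X := by
  obtain ⟨h⟩ := h
  exact h

lemma eq_one_of_isLen_of_simple {X : A} {n : ℕ} (h : IsLen X n) (hX : Simple X) : n = 1 := by
  cases h with
  | zero h => exact (Simple.not_isZero _ h).elim
  | succ f g w h hZ hn =>
    have := h.mono_f
    have := h.epi_g
    by_cases hf : f = 0
    · have h0 : IsZero _ := IsZero.of_mono_eq_zero f hf
      rw [eq_zero_of_isLen_of_isZero hn h0]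
    · have := isIso_of_mono_of_nonzero hf
      have hg : g = 0 := by rw [← cancel_epi f, w, comp_zero]
      exact (Simple.not_isZero _ (IsZero.of_epi_eq_zero g hg)).elim

lemma IsLen.exists_add_of_shortExact {X : A} {n : ℕ} (h : IsLen X n) :
    ∀ {Y Z : A} (i : Y ⟶ X) (p : X ⟶ Z) (w : i ≫ p = 0), (ShortComplex.mk i p w).ShortExact →
      ∃ a b, IsLen Y a ∧ IsLen Z b ∧ a + b = n := by
  induction h with
  | zero hX =>
    intro Y Z i p w h
    have := h.mono_f
    have := h.epi_g
    exact ⟨0, 0, .zero (hX.of_mono i), .zero (hX.of_epi p), rfl⟩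
  | @succ X' X S n f g w h hS _ ih =>
    intro Y Z i p w' h'
    have := h.mono_f
    have := h.epi_g
    have := h'.mono_f
    have := h'.epi_g
    by_cases h0 : i ≫ g = 0
    · -- the subobject `Y` is contained in `X'`
      obtain ⟨j, hj⟩ : ∃ j : Y ⟶ X', j ≫ f = i := ⟨h.exact.lift i h0, h.exact.lift_f i h0⟩
      have : Mono j := mono_of_mono_fac hj
      obtain ⟨q, hq⟩ : ∃ q : Z ⟶ S, p ≫ q = g := ⟨h'.exact.desc g h0, h'.exact.g_desc g h0⟩
      have : Epi q := epi_of_epi_fac hq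
      obtain ⟨a, b, ha, hb, e⟩ := ih j (cokernel.π j) (cokernel.condition j) (shortExact_cokernel j)
      have wm : j ≫ f ≫ p = 0 := by rw [reassoc_of% hj, w']
      have hm : (ShortComplex.mk j (f ≫ p) wm).Exact := by
        rw [ShortComplex.exact_iff_exact_up_to_refinements]
        intro T x hx
        obtain ⟨T', π, hπ, y, hy⟩ := h'.exact.exact_up_to_refinements (x ≫ f) (by simpa using hx)
        refine ⟨T', π, hπ, y, ?_⟩
        dsimp at hy ⊢
        rw [← cancel_mono f, Category.assoc, Category.assoc, hy, hj]
      let m : cokernel j ⟶ Z := cokernel.desc j (f ≫ p) wm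
      have hmono : Mono m := hm.mono_cokernelDesc
      have wq : m ≫ q = 0 := by
        rw [← cancel_epi (cokernel.π j)]
        simp [m, hq, w]
      refine ⟨a, b + 1, ha, .succ m q wq { exact := ?_ } hS hb, by omega⟩
      rw [ShortComplex.exact_iff_exact_up_to_refinements]
      intro T z hz
      obtain ⟨T', π, hπ, x, hx⟩ := surjective_up_to_refinements_of_epi p z
      obtain ⟨T'', π', hπ', x', hx'⟩ := h.exact.exact_up_to_refinements x (by
        dsimp at hz ⊢
        have : x ≫ p ≫ q = 0 := by rw [← reassoc_of% hx, hz, comp_zero]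
        rwa [hq] at this)
      refine ⟨T'', π' ≫ π, inferInstance, x' ≫ cokernel.π j, ?_⟩
      dsimp at hx hx' ⊢
      simp only [m, Category.assoc, cokernel.π_desc]
      rw [hx, reassoc_of% hx']
    · -- the subobject `Y` surjects onto `S`
      have : Epi (i ≫ g) := epi_of_nonzero_to_simple h0
      let j : kernel (i ≫ g) ⟶ X' := h.exact.lift (kernel.ι (i ≫ g) ≫ i) (by simp)
      have hj : j ≫ f = kernel.ι (i ≫ g) ≫ i := h.exact.lift_f _ _
      have : Mono (j ≫ f) := by rw [hj]; infer_instance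
      have : Mono j := mono_of_mono j f
      have wm : j ≫ f ≫ p = 0 := by rw [reassoc_of% hj, w', comp_zero]
      obtain ⟨a, b, ha, hb, e⟩ := ih j (f ≫ p) wm
        { exact := by
            rw [ShortComplex.exact_iff_exact_up_to_refinements]
            intro T x hx
            obtain ⟨T', π, hπ, y, hy⟩ :=
              h'.exact.exact_up_to_refinements (x ≫ f) (by simpa using hx)
            dsimp at hy ⊢
            refine ⟨T', π, hπ, kernel.lift _ y ?_, ?_⟩
            · rw [← reassoc_of% hy, w, comp_zero, comp_zero]
            · rw [← cancel_mono f, Category.assoc, Category.assoc, hj, kernel.lift_ι_assoc, hy]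
          epi_g := by
            dsimp
            rw [epi_iff_surjective_up_to_refinements]
            intro T z
            obtain ⟨T', π, hπ, x, hx⟩ := surjective_up_to_refinements_of_epi p z
            obtain ⟨T'', π', hπ', y, hy⟩ := surjective_up_to_refinements_of_epi (i ≫ g) (x ≫ g)
            obtain ⟨T₃, π₃, hπ₃, x', hx'⟩ :=
              h.exact.exact_up_to_refinements (π' ≫ x - y ≫ i) (by simp [hy])
            refine ⟨T₃, π₃ ≫ π' ≫ π, inferInstance, x', ?_⟩
            dsimp at hx'
            rw [← reassoc_of% hx', Category.assoc, Category.assoc, hx]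
            simp [w'] }
      exact ⟨a + 1, b, .succ _ (i ≫ g) (kernel.condition _) (shortExact_kernel _) hS ha, hb,
        by omega⟩

/-- Uniqueness of the length. -/
lemma IsLen.unique {X : A} {m n : ℕ} (hm : IsLen X m) (hn : IsLen X n) : m = n := by
  induction hm generalizing n with
  | zero hX => exact (eq_zero_of_isLen_of_isZero hn hX).symm
  | succ f g w h hZ _ ih =>
    obtain ⟨a, b, ha, hb, rfl⟩ := hn.exists_add_of_shortExact f g w h
    rw [ih ha, eq_one_of_isLen_of_simple hb hZ]

lemma HasLength.isLen {X : A} {n : ℕ} (h : HasLength X n) : IsLen X n := by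
  obtain ⟨s, -, h0, h1, hs⟩ := h
  have key : ∀ k : Fin (n + 1), IsLen (s k : A) k := fun k => by
    induction k using Fin.induction with
    | zero =>
      rw [h0]
      exact .zero ((isZero_zero A).of_iso Subobject.botCoeIsoZero)
    | succ i ih =>
      obtain ⟨hle, hsimple⟩ := hs i
      exact .succ _ _ _ (shortExact_cokernel (Subobject.ofLE _ _ hle)) hsimple ih
  have h2 := key (Fin.last n)
  rw [h1] at h2
  exact h2.of_iso (asIso (⊤ : Subobject X).arrow)

lemma IsLen.exists_filtration {X : A} {n : ℕ} (P : Subobject X) (h : IsLen (P : A) n) :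
    ∃ s : Fin (n + 1) → Subobject X, s 0 = ⊥ ∧ s (Fin.last n) = P ∧
      ∀ i : Fin n, ∃ h : s i.castSucc ≤ s i.succ,
        Simple (cokernel (Subobject.ofLE _ _ h)) := by
  induction n generalizing P with
  | zero =>
    refine ⟨fun _ => P, ?_, rfl, fun i => i.elim0⟩
    cases h with
    | zero h =>
      rw [← Subobject.mk_arrow P, Subobject.mk_eq_bot_iff_zero]
      exact h.eq_of_src _ _
  | succ n ih =>
    cases h with
    | @succ Y _ Z _ f g w h hZ hY =>
      have : Mono f := h.mono_f
      have : Epi g := h.epi_g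
      let Q : Subobject X := Subobject.mk (f ≫ P.arrow)
      have hQ : Q ≤ P := Subobject.mk_le_of_comm f rfl
      obtain ⟨s, h0, h1, hs⟩ := ih Q (hY.of_iso (Subobject.underlyingIso (f ≫ P.arrow)).symm)
      have hfac : (Subobject.underlyingIso (f ≫ P.arrow)).inv ≫ Subobject.ofLE Q P hQ = f := by
        rw [← cancel_mono P.arrow]
        simp [Q]
      have hsimple : Simple (cokernel (Subobject.ofLE Q P hQ)) := by
        refine (Simple.iff_of_iso ?_).1 hZ
        exact (IsColimit.coconePointUniqueUpToIso h.gIsCokernel (cokernelIsCokernel f)) ≪≫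
          cokernel.mapIso f _ (Subobject.underlyingIso (f ≫ P.arrow)).symm (Iso.refl _)
            (by simp [hfac])
      refine ⟨Fin.snoc s P, ?_, by simp, fun i => ?_⟩
      · rw [← Fin.castSucc_zero, Fin.snoc_castSucc, h0]
      · have aux : ∀ R T : Subobject X, R = Q → T = P →
            ∃ h : R ≤ T, Simple (cokernel (Subobject.ofLE _ _ h)) := by
          rintro _ _ rfl rfl
          exact ⟨hQ, hsimple⟩
        induction i using Fin.lastCases with
        | last => exact aux _ _ (by rw [Fin.snoc_castSucc, h1]) (by simp)
        | cast i =>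
          rw [Fin.succ_castSucc, Fin.snoc_castSucc, Fin.snoc_castSucc]
          exact hs i

lemma hasLength_iff_isLen {X : A} {n : ℕ} : HasLength X n ↔ IsLen X n := by
  refine ⟨HasLength.isLen, fun h => ?_⟩
  obtain ⟨s, h0, h1, hs⟩ := IsLen.exists_filtration ⊤ (h.of_iso (asIso (⊤ : Subobject X).arrow).symm)
  exact ⟨s, Fin.monotone_iff_le_succ.2 fun i => (hs i).1, h0, h1, hs⟩

end Length

section Lift

lemma Shortening.simple_or_isZero {A : Type u₁} {B : Type u₂} [Category.{v₁} A] [Abelian A]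
    [Category.{v₂} B] [Abelian B] {G : A ⥤ B} (hG : Shortening G) (hB : FiniteLength B)
    {S : A} (hS : Simple S) : Simple (G.obj S) ∨ IsZero (G.obj S) := by
  obtain ⟨m, hm⟩ := hB (G.obj S)
  have hle := hG S 1 m (hasLength_iff_isLen.2 (isLen_one_of_simple hS)) hm
  rw [hasLength_iff_isLen] at hm
  interval_cases m
  · exact Or.inr (isZero_of_isLen_zero hm)
  · exact Or.inl (simple_of_isLen_one hm)

variable {C : ℕ → Type u} [∀ i, Category.{v} (C i)] {F : ∀ i : ℕ, C (i + 1) ⥤ C i}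
  {A : Type u₁} [Category.{v₁} A] {G : ∀ i, A ⥤ C i}

/-- The functor to `lim C_i` induced by functors to the `C_i` compatible with the transition
functors. -/
def lift (η : ∀ i : ℕ, G (i + 1) ⋙ F i ≅ G i) : A ⥤ Obj F where
  obj a := ⟨fun i => (G i).obj a, fun i => (η i).app a⟩
  map f := homMk (fun i => (G i).map f) fun i => (η i).hom.naturality f
  map_id a := by ext i; exact (G i).map_id a
  map_comp f g := by ext i; exact (G i).map_comp f g

/-- The components of the induced functor. -/
def liftCompPr (η : ∀ i : ℕ, G (i + 1) ⋙ F i ≅ G i) (i : ℕ) : lift η ⋙ Pr F i ≅ G i :=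
  Iso.refl _

lemma isIso_Pr_map_of_le {X Y : Obj F} (f : X ⟶ Y) {i j : ℕ} (hij : i ≤ j)
    (h : IsIso ((Pr F j).map f)) : IsIso ((Pr F i).map f) := by
  induction j, hij using Nat.le_induction with
  | base => exact h
  | succ j _ ih =>
    refine ih ?_
    rw [← NatIso.isIso_map_iff (prCompIso F j) f, Functor.comp_map]
    infer_instance

lemma preservesFiniteLimits_lift [∀ i, PreservesFiniteLimits (F i)]
    [∀ i, PreservesFiniteLimits (G i)] (η : ∀ i : ℕ, G (i + 1) ⋙ F i ≅ G i) :
    PreservesFiniteLimits (lift η) where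
  preservesFiniteLimits J _ _ :=
    have (i : ℕ) : PreservesLimitsOfShape J (lift η ⋙ Pr F i) :=
      preservesLimitsOfShape_of_natIso (liftCompPr η i).symm
    preservesLimitsOfShape_of_comp_Pr _

lemma preservesFiniteColimits_lift [∀ i, PreservesFiniteColimits (F i)]
    [∀ i, PreservesFiniteColimits (G i)] (η : ∀ i : ℕ, G (i + 1) ⋙ F i ≅ G i) :
    PreservesFiniteColimits (lift η) where
  preservesFiniteColimits J _ _ :=
    have (i : ℕ) : PreservesColimitsOfShape J (lift η ⋙ Pr F i) :=
      preservesColimitsOfShape_of_natIso (liftCompPr η i).symm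
    preservesColimitsOfShape_of_comp_Pr _

variable [∀ i, Abelian (C i)]

lemma isLen_le_of_le (hfl : ∀ i, FiniteLength (C i)) (hshort : ∀ i, Shortening (F i))
    (X : Obj F) {i j m n : ℕ} (hij : i ≤ j) (hm : IsLen (X.obj i) m) (hn : IsLen (X.obj j) n) :
    m ≤ n := by
  induction j, hij using Nat.le_induction generalizing n with
  | base => exact (hm.unique hn).le
  | succ j _ ih =>
    obtain ⟨k, hk⟩ := hfl j (X.obj j)
    refine (ih hk.isLen).trans (hshort j _ n k (hasLength_iff_isLen.2 hn) ?_)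
    exact hasLength_iff_isLen.2 (hk.isLen.of_iso (X.iso j).symm)

lemma isZero_Pr_obj_of_le [∀ i, PreservesFiniteLimits (F i)] (X : Obj F) {i j : ℕ} (hij : i ≤ j)
    (h : IsZero ((Pr F j).obj X)) : IsZero ((Pr F i).obj X) := by
  induction j, hij using Nat.le_induction with
  | base => exact h
  | succ j _ ih =>
    have := additive_of_preservesFiniteLimits (F j)
    exact ih (((F j).map_isZero h).of_iso ((prCompIso F j).app X).symm)

variable [∀ i, PreservesFiniteLimits (F i)] [∀ i, PreservesFiniteColimits (F i)]

instance (i : ℕ) : PreservesFiniteLimits (Pr F i) := ⟨fun _ _ _ => inferInstance⟩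

instance (i : ℕ) : PreservesFiniteColimits (Pr F i) := ⟨fun _ _ _ => inferInstance⟩

lemma isZero_of_isZero_Pr_obj (X : Obj F) (h : ∀ i, IsZero ((Pr F i).obj X)) : IsZero X := by
  let _ := abelian F
  rw [IsZero.iff_id_eq_zero]
  ext i
  exact (h i).eq_of_src _ _

/-- A nonzero object of `lim C_i` whose components are simple or zero is simple. -/
lemma simple_of_simple_Pr_obj (X : Obj F)
    (h : ∀ i, Simple ((Pr F i).obj X) ∨ IsZero ((Pr F i).obj X))
    (hX : ∃ i, ¬ IsZero ((Pr F i).obj X)) :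
    letI := abelian F
    Simple X := by
  let _ := abelian F
  have hadd (i : ℕ) : (Pr F i).Additive := additive_of_preservesFiniteLimits (Pr F i)
  refine ⟨fun {Y} f _ => ⟨?_, fun hf => ?_⟩⟩
  · rintro hiso rfl
    obtain ⟨i, hi⟩ := hX
    exact hi ((Pr F i).map_isZero (IsZero.of_epi_zero Y X))
  · obtain ⟨i, hi⟩ : ∃ i, (Pr F i).map f ≠ 0 := by
      by_contra! H
      exact hf (by ext i; rw [H i, Functor.map_zero])
    have hi' : ¬ IsZero ((Pr F i).obj X) := fun H => hi (H.eq_of_tgt _ _)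
    have hsimple : Simple ((Pr F i).obj X) := (h i).resolve_right hi'
    have hiso : IsIso ((Pr F i).map f) := isIso_of_mono_of_nonzero hi
    refine isIso_of_isIso_Pr_map f fun j => ?_
    rcases le_total j i with hji | hij
    · exact isIso_Pr_map_of_le f hji hiso
    · have : Simple ((Pr F j).obj X) :=
        (h j).resolve_right fun H => hi' (isZero_Pr_obj_of_le X hij H)
      refine isIso_of_mono_of_nonzero fun H => hi' ?_
      have hY : IsZero ((Pr F j).obj Y) := IsZero.of_mono_eq_zero _ H
      exact (isZero_Pr_obj_of_le Y hij hY).of_iso (asIso ((Pr F i).map f)).symm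

variable [Abelian A] [∀ i, PreservesFiniteLimits (G i)] [∀ i, PreservesFiniteColimits (G i)]

/-- The length of the image of `a` in `lim C_i` is the eventual value of the lengths of its
components. -/
lemma exists_isLen_lift (η : ∀ i : ℕ, G (i + 1) ⋙ F i ≅ G i)
    (hG : ∀ (S : A), Simple S → ∀ i, Simple ((G i).obj S) ∨ IsZero ((G i).obj S))
    {a : A} {n : ℕ} (h : IsLen a n) :
    letI := abelian F
    ∃ m ≤ n, IsLen ((lift η).obj a) m ∧ ∃ i₀, ∀ i ≥ i₀, IsLen ((G i).obj a) m := by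
  let _ := abelian F
  have := preservesFiniteLimits_lift η
  have := preservesFiniteColimits_lift η
  have hadd : (lift η).Additive := additive_of_preservesFiniteLimits _
  have hGadd (i : ℕ) : (G i).Additive := additive_of_preservesFiniteLimits _
  induction h with
  | zero ha =>
    exact ⟨0, le_rfl, .zero ((lift η).map_isZero ha), 0, fun i _ => .zero ((G i).map_isZero ha)⟩
  | @succ a' a S n f g w h hS _ ih =>
    obtain ⟨m, hmn, hm, i₀, hi₀⟩ := ih
    by_cases hS0 : ∀ i, IsZero ((G i).obj S)
    · have hz : IsZero ((lift η).obj S) := isZero_of_isZero_Pr_obj _ hS0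
      have hiso : IsIso ((lift η).map f) :=
        (h.map_of_exact (lift η)).isIso_f_iff.2 hz
      have hiso' (i : ℕ) : IsIso ((G i).map f) :=
        (h.map_of_exact (G i)).isIso_f_iff.2 (hS0 i)
      exact ⟨m, by omega, hm.of_iso (asIso ((lift η).map f)), i₀,
        fun i hi => (hi₀ i hi).of_iso (asIso ((G i).map f))⟩
    · push Not at hS0
      have hsimple : Simple ((lift η).obj S) := simple_of_simple_Pr_obj _ (hG S hS) hS0
      obtain ⟨i₁, hi₁⟩ := hS0
      refine ⟨m + 1, by omega, .succ _ _ _ (h.map_of_exact (lift η)) hsimple hm,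
        max i₀ i₁, fun i hi => ?_⟩
      have hsimple' : Simple ((G i).obj S) := (hG S hS i).resolve_right fun H =>
        hi₁ (isZero_Pr_obj_of_le ((lift η).obj S) (le_trans (le_max_right _ _) hi) H)
      exact .succ _ _ _ (h.map_of_exact (G i)) hsimple' (hi₀ i (le_trans (le_max_left _ _) hi))

end Lift

end InvLim


open CategoryTheory Limits InvLim in
/-- Universal property of the restricted inverse limit: given a finite-length category `A` with
shortening (exact) functors `G_i : A ⥤ C_i` and natural isomorphisms `F_{i,i+1} ∘ G_{i+1} ≅ G_i`,
the induced functor `G : A ⥤ lim C_i`, `a ↦ ({G_i(a)}, {η_i})`, lands in the restricted inverse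
limit, is itself shortening with `ℓ(G(a)) = max_i ℓ(G_i(a)) ≤ ℓ(a)`, and satisfies
`Pr_i ∘ G ≅ G_i` for every `i`. -/
theorem stmt_14 {C : ℕ → Type u} [∀ i, Category.{v} (C i)] [∀ i, Abelian (C i)]
    (hfl : ∀ i, FiniteLength (C i)) (F : ∀ i : ℕ, C (i + 1) ⥤ C i)
    [∀ i, PreservesFiniteLimits (F i)] [∀ i, PreservesFiniteColimits (F i)]
    (hshort : ∀ i, Shortening (F i))
    {A : Type u} [Category.{v} A] [Abelian A] (hflA : FiniteLength A)
    (G : ∀ i, A ⥤ C i)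
    [∀ i, PreservesFiniteLimits (G i)] [∀ i, PreservesFiniteColimits (G i)]
    (hGshort : ∀ i, Shortening (G i))
    (η : ∀ i : ℕ, G (i + 1) ⋙ F i ≅ G i) :
    ∃ Ab : Abelian (InvLim.Obj F), letI := Ab;
    ∃ Glim : A ⥤ InvLim.Obj F,
      (∀ (a : A) (i : ℕ), (Glim.obj a).obj i = (G i).obj a) ∧
      (∀ (a : A) (i : ℕ), HEq ((Glim.obj a).iso i) ((η i).app a)) ∧
      (∀ a : A, RestrP F (Glim.obj a)) ∧
      (∀ i, Nonempty (Glim ⋙ InvLim.Pr F i ≅ G i)) ∧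
      (∀ (a : A) (n : ℕ), HasLength a n →
        ∃ m : ℕ, HasLength (Glim.obj a) m ∧ m ≤ n ∧
          IsGreatest {k : ℕ | ∃ i, HasLength ((G i).obj a) k} m) := by
  let _ := abelian F
  refine ⟨abelian F, lift η, fun _ _ => rfl, fun _ _ => HEq.rfl, fun a => ?_,
    fun i => ⟨liftCompPr η i⟩, fun a n ha => ?_⟩
  · obtain ⟨N, hN⟩ := hflA a
    exact ⟨N, fun i n hn => hGshort i a N n hN hn⟩
  · obtain ⟨m, hmn, hm, i₀, hi₀⟩ := exists_isLen_lift η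
      (fun S hS i => (hGshort i).simple_or_isZero (hfl i) hS) ha.isLen
    refine ⟨m, hasLength_iff_isLen.2 hm, hmn, ⟨i₀, hasLength_iff_isLen.2 (hi₀ i₀ le_rfl)⟩, ?_⟩
    rintro k ⟨i, hk⟩
    exact isLen_le_of_le hfl hshort ((lift η).obj a) (le_max_left i i₀) hk.isLen
      (hi₀ _ (le_max_right i i₀))
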